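/- Let G = (V, E, o, t) be a finite weakly connected even directed multigraph with |V| ≥ 2. Then there exists an enumeration e_1, …, e_m of E having exactly two bad edges. Moreover, for any prescribed f ∈ E, the enumeration can be chosen so that f is one of the two bad edges. -/

import Mathlib

open Finset

/-- Given an enumeration `π : Fin m ≃ E` of the edges, a vertex `w` *starts* at position `t` if
`w` is an endpoint of `π t` and is not an endpoint of any earlier edge. -/
def startsAt {V E : Type} (o τ : E → V) {m : ℕ} (π : Fin m ≃ E) (w : V) (t : Fin m) : Prop :=
  (w = o (π t) ∨ w = τ (π t)) ∧ ∀ u : Fin m, u < t → w ≠ o (π u) ∧ w ≠ τ (π u)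

/-- A vertex `w` *ends* at position `t` if `w` is an endpoint of `π t` and is not an endpoint of
any later edge. -/
def endsAt {V E : Type} (o τ : E → V) {m : ℕ} (π : Fin m ≃ E) (w : V) (t : Fin m) : Prop :=
  (w = o (π t) ∨ w = τ (π t)) ∧ ∀ u : Fin m, t < u → w ≠ o (π u) ∧ w ≠ τ (π u)

/-- An edge at position `t` is *bad* (for the enumeration `π`) if its origin and terminus both
start at `t`, or both end at `t`. -/
def BadEdge {V E : Type} (o τ : E → V) {m : ℕ} (π : Fin m ≃ E) (t : Fin m) : Prop :=
  (startsAt o τ π (o (π t)) t ∧ startsAt o τ π (τ (π t)) t) ∨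
    (endsAt o τ π (o (π t)) t ∧ endsAt o τ π (τ (π t)) t)


section Helpers

variable {α : Type}

/-- A relation path from outside `S` into `S` gives a nodup chain outside `S` with last vertex
adjacent to a vertex of `S`. -/
theorem aux_path (R : α → α → Prop) (S : α → Prop) {z y₀ : α}
    (h : Relation.ReflTransGen R z y₀) (hy : S y₀) : ¬ S z →
    ∃ p : List α, (z :: p).Nodup ∧ (∀ e ∈ z :: p, ¬ S e) ∧
      ∃ y, S y ∧ List.IsChain R (z :: p ++ [y]) := by
  induction h using Relation.ReflTransGen.head_induction_on with
  | refl => intro h; exact absurd hy h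
  | head hab hbc ih =>
    clear hbc
    rename_i a b
    intro ha
    by_cases hb : S b
    · exact ⟨[], by simp, by simpa using ha, b, hb, by simpa using hab⟩
    · obtain ⟨p, hnd, hS, y, hy', hch⟩ := ih hb
      by_cases hmem : a ∈ b :: p
      · obtain ⟨l₁, l₂, hl⟩ := List.append_of_mem hmem
        rw [hl] at hnd hS hch
        refine ⟨l₂, ?_, ?_, y, hy', ?_⟩
        · exact (List.nodup_append.1 hnd).2.1
        · intro e he; exact hS e (by simp only [List.mem_append]; exact Or.inr he)
        · rw [List.append_assoc] at hch
          exact hch.right_of_append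
      · refine ⟨b :: p, List.nodup_cons.2 ⟨hmem, hnd⟩, ?_, y, hy', ?_⟩
        · intro e he
          rcases List.mem_cons.1 he with rfl | he
          · exact ha
          · exact hS e he
        · exact List.IsChain.cons_cons hab hch

theorem aux_chain (R : α → α → Prop) (x y e : α) (p : List α)
    (h : List.IsChain R (x :: p ++ [y])) (he : e ∈ p) :
    (∃ a, R a e ∧ List.Sublist [a, e] (x :: p ++ [y])) ∧
    (∃ b, R e b ∧ List.Sublist [e, b] (x :: p ++ [y])) := by
  obtain ⟨p₁, p₂, rfl⟩ := List.append_of_mem he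
  constructor
  · rcases List.eq_nil_or_concat (x :: p₁) with h0 | ⟨q, a, hq⟩
    · simp at h0
    · have hi : [a, e] <:+: (x :: (p₁ ++ e :: p₂) ++ [y]) := by
        refine ⟨q, p₂ ++ [y], ?_⟩
        have : x :: (p₁ ++ e :: p₂) ++ [y] = (x :: p₁) ++ (e :: p₂ ++ [y]) := by simp
        rw [this, hq]; simp
      refine ⟨a, ?_, hi.sublist⟩
      simpa using h.infix hi
  · obtain ⟨b, q, hq⟩ : ∃ b q, p₂ ++ [y] = b :: q := by
      cases p₂ with
      | nil => exact ⟨y, [], rfl⟩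
      | cons c p => exact ⟨c, p ++ [y], rfl⟩
    have hi : [e, b] <:+: (x :: (p₁ ++ e :: p₂) ++ [y]) := by
      refine ⟨x :: p₁, q, ?_⟩
      have : x :: (p₁ ++ e :: p₂) ++ [y] = (x :: p₁) ++ (e :: (p₂ ++ [y])) := by simp
      rw [this, hq]; simp
    refine ⟨b, ?_, hi.sublist⟩
    simpa using h.infix hi

/-- The list `l` is an `st`-ordering of its members. -/
def StList (R : α → α → Prop) (s t : α) (l : List α) : Prop :=
  l.Nodup ∧ l.head? = some s ∧ l.getLast? = some t ∧
    ∀ e ∈ l, e ≠ s → e ≠ t → (∃ a, R a e ∧ List.Sublist [a, e] l) ∧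
      (∃ b, R e b ∧ List.Sublist [e, b] l)

theorem aux_insert (R : α → α → Prop) (s t x y : α) (l₁ l₂ p : List α)
    (h : StList R s t (l₁ ++ x :: l₂)) (hy : y ∈ l₂)
    (hp : p.Nodup) (hd : ∀ e ∈ p, e ∉ l₁ ++ x :: l₂)
    (hc : List.IsChain R (x :: p ++ [y])) :
    StList R s t (l₁ ++ x :: (p ++ l₂)) := by
  obtain ⟨hnd, hh, hl, hg⟩ := h
  have hsub : List.Sublist (l₁ ++ x :: l₂) (l₁ ++ x :: (p ++ l₂)) := by
    apply List.Sublist.append_left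
    apply List.Sublist.cons_cons
    exact List.sublist_append_right _ _
  have hsub2 : List.Sublist (x :: p ++ [y]) (l₁ ++ x :: (p ++ l₂)) := by
    refine List.Sublist.trans ?_ (List.sublist_append_right _ _)
    simp only [List.cons_append]
    apply List.Sublist.cons_cons
    apply List.Sublist.append_left
    simpa using hy
  refine ⟨?_, ?_, ?_, ?_⟩
  · have hperm : (l₁ ++ x :: (p ++ l₂)).Perm (p ++ (l₁ ++ x :: l₂)) := by
      have h1 : (l₁ ++ x :: (p ++ l₂)) = (l₁ ++ [x]) ++ (p ++ l₂) := by simp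
      have h2 : (p ++ (l₁ ++ x :: l₂)) = p ++ ((l₁ ++ [x]) ++ l₂) := by simp
      rw [h1, h2, ← List.append_assoc, ← List.append_assoc]
      exact List.Perm.append_right _ List.perm_append_comm
    rw [hperm.nodup_iff, List.nodup_append]
    refine ⟨hp, hnd, ?_⟩
    rintro a ha b hb rfl
    exact hd a ha hb
  · cases l₁ <;> simpa using hh
  · have hne : l₂ ≠ [] := List.ne_nil_of_mem hy
    have h1 : (l₁ ++ x :: (p ++ l₂)) = (l₁ ++ x :: p) ++ l₂ := by simp
    have h2 : (l₁ ++ x :: l₂) = (l₁ ++ [x]) ++ l₂ := by simp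
    rw [h2, List.getLast?_append_of_ne_nil _ hne] at hl
    rw [h1, List.getLast?_append_of_ne_nil _ hne, hl]
  · intro e he hes het
    by_cases hep : e ∈ p
    · obtain ⟨⟨a, ha, ha'⟩, ⟨b, hb, hb'⟩⟩ := aux_chain R x y e p hc hep
      exact ⟨⟨a, ha, ha'.trans hsub2⟩, ⟨b, hb, hb'.trans hsub2⟩⟩
    · have he' : e ∈ l₁ ++ x :: l₂ := by
        simp only [List.mem_append, List.mem_cons] at he ⊢
        tauto
      obtain ⟨h1, h2⟩ := hg e he' hes het
      obtain ⟨a, ha, ha'⟩ := h1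
      obtain ⟨b, hb, hb'⟩ := h2
      exact ⟨⟨a, ha, ha'.trans hsub⟩, ⟨b, hb, hb'.trans hsub⟩⟩

theorem aux_step (R : α → α → Prop) (hsymm : ∀ a b, R a b → R b a)
    (h2 : ∀ x a b, a ≠ x → b ≠ x → Relation.ReflTransGen (fun a b => R a b ∧ b ≠ x) a b)
    (s t : α) (hst : s ≠ t) (l : List α) (h : StList R s t l) (z : α) (hz : z ∉ l) :
    ∃ l', StList R s t l' ∧ l.length < l'.length := by
  have hs : s ∈ l := List.mem_of_head? h.2.1
  have ht : t ∈ l := List.mem_of_getLast? h.2.2.1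
  -- an edge between the list and its complement
  obtain ⟨x, w, hx, hw, hwx⟩ : ∃ x w, x ∈ l ∧ w ∉ l ∧ R w x := by
    obtain ⟨p, _, hS, y, hy, hc⟩ := aux_path _ (· ∈ l)
      (h2 s z t (fun h => hz (h ▸ hs)) hst.symm) ht hz
    rcases List.eq_nil_or_concat (z :: p) with h0 | ⟨q, a, hq⟩
    · simp at h0
    · refine ⟨y, a, hy, hS a (by rw [hq]; simp), ?_⟩
      rw [hq] at hc
      have hi : [a, y] <:+: (q.concat a ++ [y]) := ⟨q, [], by simp⟩
      have := hc.infix hi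
      simp at this
      exact this.1
  obtain ⟨y₀, hy₀, hyx⟩ : ∃ y₀ ∈ l, y₀ ≠ x := by
    by_cases hsx : s = x
    · exact ⟨t, ht, fun h => hst (hsx.trans h.symm)⟩
    · exact ⟨s, hs, hsx⟩
  obtain ⟨p, hnd, hS, y, hy, hc⟩ := aux_path _ (· ∈ l)
      (h2 x w y₀ (fun h => hw (h ▸ hx)) hyx) hy₀ hw
  have hyx' : y ≠ x := by
    rcases List.eq_nil_or_concat (w :: p) with h0 | ⟨q, a, hq⟩
    · simp at h0
    · rw [hq] at hc
      have hi : [a, y] <:+: (q.concat a ++ [y]) := ⟨q, [], by simp⟩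
      have := hc.infix hi
      simp at this
      exact this.2
  have hc' : List.IsChain R (x :: (w :: p) ++ [y]) := by
    have h1 : List.IsChain R (w :: p ++ [y]) := hc.imp (fun _ _ h => h.1)
    exact List.IsChain.cons_cons (hsymm _ _ hwx) h1
  obtain ⟨l₁, l₂, rfl⟩ := List.append_of_mem hx
  simp only [List.mem_append, List.mem_cons, hyx', false_or] at hy
  rcases hy with hy | hy
  · obtain ⟨m₁, m₂, rfl⟩ := List.append_of_mem hy
    have e1 : (m₁ ++ y :: m₂ ++ x :: l₂) = m₁ ++ y :: (m₂ ++ x :: l₂) := by simp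
    rw [e1] at h hS ⊢
    refine ⟨_, aux_insert R s t y x m₁ (m₂ ++ x :: l₂) (w :: p).reverse h (by simp)
      (List.nodup_reverse.2 hnd) ?_ ?_, ?_⟩
    · intro e he; exact hS e (List.mem_reverse.1 he)
    · have h3 : List.IsChain (flip R) (x :: (w :: p) ++ [y]) := hc'.imp (fun a b h => hsymm _ _ h)
      have h4 := List.isChain_reverse.2 h3
      simpa [flip] using h4
    · simp
  · refine ⟨_, aux_insert R s t x y l₁ l₂ (w :: p) h hy hnd hS hc', ?_⟩
    simp

theorem aux_exists [Fintype α] (R : α → α → Prop) (hsymm : ∀ a b, R a b → R b a)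
    (h2 : ∀ x a b, a ≠ x → b ≠ x → Relation.ReflTransGen (fun a b => R a b ∧ b ≠ x) a b)
    (s t : α) (hst : s ≠ t) : ∃ l, StList R s t l ∧ ∀ e, e ∈ l := by
  have key : ∀ k (l : List α), StList R s t l → Fintype.card α - l.length ≤ k →
      ∃ l', StList R s t l' ∧ ∀ e, e ∈ l' := by
    intro k
    induction k with
    | zero =>
      intro l hl hk
      refine ⟨l, hl, ?_⟩
      by_contra! hcon
      obtain ⟨z, hz⟩ := hcon
      have := (List.nodup_cons.2 ⟨hz, hl.1⟩).length_le_card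
      simp at this
      omega
    | succ k ih =>
      intro l hl hk
      by_cases hall : ∀ e, e ∈ l
      · exact ⟨l, hl, hall⟩
      · push Not at hall
        obtain ⟨z, hz⟩ := hall
        obtain ⟨l', hl', hlt⟩ := aux_step R hsymm h2 s t hst l hl z hz
        exact ih l' hl' (by omega)
  refine key _ [s, t] ⟨by simpa using hst, rfl, rfl, ?_⟩ le_rfl
  intro e he hes het
  simp only [List.mem_cons, List.not_mem_nil, or_false] at he
  tauto

end Helpers

/-- Two edges share an endpoint. -/
def Touch {V E : Type} (o τ : E → V) (a b : E) : Prop :=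
  ∃ v, (o a = v ∨ τ a = v) ∧ (o b = v ∨ τ b = v)

theorem aux_two_conn {V E : Type} [Fintype V] [Fintype E] [DecidableEq V]
    (o τ : E → V)
    (heven : ∀ v : V, Even ((Finset.univ.filter fun e => o e = v).card +
      (Finset.univ.filter fun e => τ e = v).card))
    (hconn : ∀ u v : V,
      Relation.ReflTransGen (fun x y => ∃ e, (o e = x ∧ τ e = y) ∨ (o e = y ∧ τ e = x)) u v)
    (x a b : E) (ha : a ≠ x) (hb : b ≠ x) :
    Relation.ReflTransGen (fun a b => Touch o τ a b ∧ b ≠ x) a b := by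
  classical
  set Q := Relation.ReflTransGen (fun a b => Touch o τ a b ∧ b ≠ x) a with hQ
  let W : V → Prop := fun v => ∃ c, Q c ∧ (o c = v ∨ τ c = v)
  have hin : ∀ e, e ≠ x → ∀ v, W v → (o e = v ∨ τ e = v) → Q e := by
    rintro e he v ⟨c, hc, hcv⟩ hev
    exact hc.tail ⟨⟨v, hcv, hev⟩, he⟩
  have hiff : ∀ e, e ≠ x → (W (o e) ↔ W (τ e)) := by
    intro e he
    constructor
    · intro h; exact ⟨e, hin e he _ h (Or.inl rfl), Or.inr rfl⟩
    · intro h; exact ⟨e, hin e he _ h (Or.inr rfl), Or.inl rfl⟩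
  have hsum : Even (∑ e : E, ((if W (o e) then 1 else 0) + (if W (τ e) then 1 else 0))) := by
    have h1 : ∀ g : E → V, ∑ e : E, (if W (g e) then 1 else 0) =
        ∑ v ∈ Finset.univ.filter W, (Finset.univ.filter fun e => g e = v).card := by
      intro g
      rw [← Finset.card_filter]
      rw [Finset.card_eq_sum_card_fiberwise (f := g) (t := Finset.univ.filter W)]
      · apply Finset.sum_congr rfl
        intro v hv
        congr 1
        ext e
        simp only [Finset.mem_filter, Finset.mem_univ, true_and] at hv ⊢
        constructor
        · exact fun h => h.2
        · rintro rfl; exact ⟨hv, rfl⟩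
      · intro e he; simpa using he
    rw [Finset.sum_add_distrib, h1, h1, ← Finset.sum_add_distrib]
    exact Finset.even_sum _ (fun v _ => heven v)
  have hx : W (o x) ↔ W (τ x) := by
    rw [← Finset.add_sum_erase _ _ (Finset.mem_univ x), Nat.even_add] at hsum
    have h2 : Even (∑ e ∈ Finset.univ.erase x,
        ((if W (o e) then 1 else 0) + (if W (τ e) then 1 else 0))) := by
      apply Finset.even_sum
      intro e he
      have := hiff e (Finset.ne_of_mem_erase he)
      by_cases h : W (τ e) <;> simp [this, h]
    have h3 := hsum.2 h2
    by_cases h : W (o x) <;> by_cases h' : W (τ x) <;> simp [h, h'] at h3 ⊢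
  have hall : ∀ e, (W (o e) ↔ W (τ e)) := by
    intro e
    by_cases he : e = x
    · rw [he]; exact hx
    · exact hiff e he
  have hW : ∀ v, W v := by
    intro v
    have h0 : W (o a) := ⟨a, Relation.ReflTransGen.refl, Or.inl rfl⟩
    induction hconn (o a) v with
    | refl => exact h0
    | tail _ hstep ih =>
      obtain ⟨e, ⟨rfl, rfl⟩ | ⟨rfl, rfl⟩⟩ := hstep
      · exact (hall e).1 ih
      · exact (hall e).2 ih
  exact hin b hb (o b) (hW _) (Or.inl rfl)

theorem aux_other {V E : Type} [Fintype V] [Fintype E] [DecidableEq V]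
    (o τ : E → V) (hV : 2 ≤ Fintype.card V)
    (heven : ∀ v : V, Even ((Finset.univ.filter fun e => o e = v).card +
      (Finset.univ.filter fun e => τ e = v).card))
    (hconn : ∀ u v : V,
      Relation.ReflTransGen (fun x y => ∃ e, (o e = x ∧ τ e = y) ∨ (o e = y ∧ τ e = x)) u v)
    (f : E) : ∃ t : E, f ≠ t := by
  by_contra! hcon
  by_cases hl : o f = τ f
  · have : ∀ v, v = o f := by
      intro v
      induction hconn (o f) v with
      | refl => rfl
      | tail _ hstep ih =>
        obtain ⟨e, ⟨h1, h2⟩ | ⟨h1, h2⟩⟩ := hstep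
        · rw [← h2, ← hcon e, hl]
        · rw [← h1, ← hcon e]
    have : Fintype.card V ≤ 1 := Fintype.card_le_one_iff.2 (fun a b => (this a).trans (this b).symm)
    omega
  · have h := heven (o f)
    have h1 : (Finset.univ.filter fun e => o e = o f) = {f} := by
      ext e; simp [← hcon e]
    have h2 : (Finset.univ.filter fun e => τ e = o f) = ∅ := by
      ext e; simp [← hcon e, Ne.symm hl]
    rw [h1, h2] at h
    simp at h

theorem aux_final {V E : Type} (o τ : E → V) (s t : E) (hst : s ≠ t) (l : List E)
    (h : StList (Touch o τ) s t l) (hall : ∀ e, e ∈ l) (m : ℕ) (hm : m = l.length) :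
    ∃ π : Fin m ≃ E, ∃ t₁ t₂ : Fin m, t₁ ≠ t₂ ∧
        BadEdge o τ π t₁ ∧ BadEdge o τ π t₂ ∧
        (∀ t, BadEdge o τ π t → t = t₁ ∨ t = t₂) ∧
        (π t₁ = s ∨ π t₂ = s) := by
  classical
  subst hm
  obtain ⟨hnd, hh, hl, hg⟩ := h
  have hpos : 0 < l.length := List.length_pos_of_mem (hall s)
  let π : Fin l.length ≃ E := hnd.getEquivOfForallMemList l hall
  have hπ : ∀ i, π i = l.get i := fun i => rfl
  have hs : π ⟨0, hpos⟩ = s := by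
    rw [hπ]
    rw [List.head?_eq_getElem?, List.getElem?_eq_getElem hpos] at hh
    simpa using hh
  have ht : π ⟨l.length - 1, by omega⟩ = t := by
    rw [hπ]
    rw [List.getLast?_eq_getElem?, List.getElem?_eq_getElem (by omega)] at hl
    simpa using hl
  have hsub : ∀ a b, List.Sublist [a, b] l → ∃ i j : Fin l.length, i < j ∧ π i = a ∧ π j = b := by
    intro a b hab
    obtain ⟨f, hf⟩ := List.sublist_iff_exists_fin_orderEmbedding_get_eq.1 hab
    refine ⟨f ⟨0, by simp⟩, f ⟨1, by simp⟩, ?_, ?_, ?_⟩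
    · apply f.strictMono; simp [Fin.lt_def]
    · rw [hπ, ← hf]; rfl
    · rw [hπ, ← hf]; rfl
  refine ⟨π, ⟨0, hpos⟩, ⟨l.length - 1, by omega⟩, ?_, ?_, ?_, ?_, Or.inl hs⟩
  · intro h
    apply hst
    rw [← hs, ← ht, h]
  · refine Or.inl ⟨⟨Or.inl rfl, ?_⟩, ⟨Or.inr rfl, ?_⟩⟩ <;>
    · intro u hu
      simp [Fin.lt_def] at hu
  · refine Or.inr ⟨⟨Or.inl rfl, ?_⟩, ⟨Or.inr rfl, ?_⟩⟩ <;>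
    · intro u hu
      have := u.2
      rw [Fin.lt_def] at hu
      simp only at hu
      omega
  · intro i hi
    by_cases his : π i = s
    · exact Or.inl (π.injective (his.trans hs.symm))
    by_cases hit : π i = t
    · exact Or.inr (π.injective (hit.trans ht.symm))
    exfalso
    obtain ⟨⟨a, ⟨v, hav, hiv⟩, ha⟩, ⟨b, ⟨v', hiv', hbv⟩, hb⟩⟩ := hg (π i) (hall _) his hit
    rcases hi with ⟨ho, hτ⟩ | ⟨ho, hτ⟩
    · obtain ⟨j, k, hjk, rfl, hk⟩ := hsub _ _ ha
      obtain rfl := π.injective hk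
      have A := ho.2 j hjk
      have B := hτ.2 j hjk
      grind
    · obtain ⟨j, k, hjk, hk, rfl⟩ := hsub _ _ hb
      obtain rfl := π.injective hk
      have A := ho.2 k hjk
      have B := hτ.2 k hjk
      grind

/-- A finite weakly connected even directed multigraph with at least two
vertices admits an enumeration of its edges with exactly two bad edges; moreover, for any
prescribed edge `f`, the enumeration can be chosen so that `f` is one of the two bad edges. -/
theorem exists_enumeration_two_bad_edges
    {V E : Type} [Fintype V] [Fintype E] [DecidableEq V]
    (o τ : E → V) (hV : 2 ≤ Fintype.card V)
    (heven : ∀ v : V, Even ((Finset.univ.filter fun e => o e = v).card +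
      (Finset.univ.filter fun e => τ e = v).card))
    (hconn : ∀ u v : V,
      Relation.ReflTransGen (fun x y => ∃ e, (o e = x ∧ τ e = y) ∨ (o e = y ∧ τ e = x)) u v) :
    (∃ π : Fin (Fintype.card E) ≃ E, ∃ t₁ t₂ : Fin (Fintype.card E), t₁ ≠ t₂ ∧
        BadEdge o τ π t₁ ∧ BadEdge o τ π t₂ ∧
        ∀ t, BadEdge o τ π t → t = t₁ ∨ t = t₂) ∧
      ∀ f : E, ∃ π : Fin (Fintype.card E) ≃ E, ∃ t₁ t₂ : Fin (Fintype.card E), t₁ ≠ t₂ ∧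
        BadEdge o τ π t₁ ∧ BadEdge o τ π t₂ ∧
        (∀ t, BadEdge o τ π t → t = t₁ ∨ t = t₂) ∧
        (π t₁ = f ∨ π t₂ = f) := by
  classical
  have main : ∀ f : E, ∃ π : Fin (Fintype.card E) ≃ E, ∃ t₁ t₂ : Fin (Fintype.card E), t₁ ≠ t₂ ∧
        BadEdge o τ π t₁ ∧ BadEdge o τ π t₂ ∧
        (∀ t, BadEdge o τ π t → t = t₁ ∨ t = t₂) ∧
        (π t₁ = f ∨ π t₂ = f) := by
    intro f
    obtain ⟨t, hft⟩ := aux_other o τ hV heven hconn f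
    obtain ⟨l, hl, hall⟩ := aux_exists (Touch o τ)
      (fun a b ⟨v, h1, h2⟩ => ⟨v, h2, h1⟩)
      (fun x a b ha hb => aux_two_conn o τ heven hconn x a b ha hb) f t hft
    refine aux_final o τ f t hft l hl hall _ ?_
    have h1 : l.toFinset = Finset.univ := by ext e; simp [hall e]
    rw [← Finset.card_univ, ← h1, List.toFinset_card_of_nodup hl.1]
  refine ⟨?_, main⟩
  obtain ⟨u, v, huv⟩ := Fintype.exists_pair_of_one_lt_card (show 1 < Fintype.card V by omega)
  have hE : ∃ f : E, True := by
    rcases Relation.ReflTransGen.cases_head (hconn u v) with h | ⟨_, ⟨e, _⟩, _⟩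
    · exact absurd h huv
    · exact ⟨e, trivial⟩
  obtain ⟨f, _⟩ := hE
  obtain ⟨π, t₁, t₂, h1, h2, h3, h4, _⟩ := main f
  exact ⟨π, t₁, t₂, h1, h2, h3, h4⟩
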